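/- Assume c₀, c₁, c_e > 0 and let C be a real number with 0 < C < min{c₀, c₁ + c_e·μ_x²} + c_e·σ_x². Then the equation G(γ) = C − c₁ − c_e·(μ_x² + σ_x²) has a unique solution γ > 0. -/

import Mathlib

open MeasureTheory Real Filter Set

/-- κ = σ²/σx² -/
noncomputable def kap (σ σx : ℝ) : ℝ := σ ^ 2 / σx ^ 2

/-- The marginalized likelihood ratio L(U,V). -/
noncomputable def Lf (σ σx μx U V : ℝ) : ℝ :=
  σ / σx / Real.sqrt (U + kap σ σx) *
    Real.exp ((V + μx * kap σ σx) ^ 2 / (2 * σ ^ 2 * (U + kap σ σx)) - μx ^ 2 / (2 * σx ^ 2))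

/-- The optimum estimate m(U,V). -/
noncomputable def mf (σ σx μx U V : ℝ) : ℝ :=
  (V + μx * kap σ σx) / (U + kap σ σx)

/-- ℓ(U,V) = L(U,V)(c₁ + c_e m(U,V)²). -/
noncomputable def ellf (σ σx μx c₁ ce U V : ℝ) : ℝ :=
  Lf σ σx μx U V * (c₁ + ce * (mf σ σx μx U V) ^ 2)

/-- G(U) = ∫ min{0, c₀ − ℓ(U,V)} N(0, σ²U)(dV). -/
noncomputable def Gf (σ σx μx c₀ c₁ ce U : ℝ) : ℝ :=
  ∫ V : ℝ, min 0 (c₀ - ellf σ σx μx c₁ ce U V) *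
    ((Real.sqrt (2 * Real.pi * σ ^ 2 * U))⁻¹ * Real.exp (-V ^ 2 / (2 * σ ^ 2 * U)))

open ProbabilityTheory Topology

lemma kap_pos {σ σx : ℝ} (hσ : 0 < σ) (hσx : 0 < σx) : 0 < kap σ σx := by
  unfold kap; positivity

lemma Lf_pos {σ σx : ℝ} (hσ : 0 < σ) (hσx : 0 < σx) (μx : ℝ) {U : ℝ} (hU : 0 ≤ U) (V : ℝ) :
    0 < Lf σ σx μx U V := by
  have := kap_pos hσ hσx
  unfold Lf; positivity

lemma ellf_nonneg {σ σx c₁ ce : ℝ} (hσ : 0 < σ) (hσx : 0 < σx) (hc₁ : 0 < c₁) (hce : 0 < ce)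
    (μx : ℝ) {U : ℝ} (hU : 0 ≤ U) (V : ℝ) : 0 ≤ ellf σ σx μx c₁ ce U V := by
  have := Lf_pos hσ hσx μx hU V
  unfold ellf; positivity

lemma continuous_ellf {σ σx : ℝ} (μx c₁ ce U : ℝ) : Continuous (ellf σ σx μx c₁ ce U) := by
  unfold ellf Lf mf; fun_prop

/-- Along an increment `h` of information, the likelihood ratio turns the centred Gaussian
increment into one drifting with the current estimate `mf`. -/
lemma Lf_add_mul_gaussianPDFReal {σ σx : ℝ} (hσ : 0 < σ) (hσx : 0 < σx) (μx : ℝ) {U h : ℝ}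
    (hU : 0 ≤ U) (hh : 0 < h) (v w : ℝ) :
    Lf σ σx μx (U + h) (v + w) * gaussianPDFReal 0 (σ ^ 2 * h).toNNReal w =
      Lf σ σx μx U v * gaussianPDFReal (mf σ σx μx U v * h)
        (σ ^ 2 * h * (U + h + kap σ σx) / (U + kap σ σx)).toNNReal w := by
  have hk := kap_pos hσ hσx
  unfold Lf mf gaussianPDFReal
  rw [Real.coe_toNNReal _ (by positivity), Real.coe_toNNReal _ (by positivity)]
  generalize kap σ σx = k at *
  have ha : 0 < U + k := by positivity
  have hb : 0 < U + h + k := by positivity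
  have hs : √(2 * π * (σ ^ 2 * h * (U + h + k) / (U + k))) =
      √(2 * π * (σ ^ 2 * h)) * √(U + h + k) / √(U + k) := by
    rw [← Real.sqrt_mul (by positivity), ← Real.sqrt_div (by positivity)]
    congr 1; ring
  have hexp : rexp ((v + w + μx * k) ^ 2 / (2 * σ ^ 2 * (U + h + k)) - μx ^ 2 / (2 * σx ^ 2)) *
        rexp (-(w - 0) ^ 2 / (2 * (σ ^ 2 * h))) =
      rexp ((v + μx * k) ^ 2 / (2 * σ ^ 2 * (U + k)) - μx ^ 2 / (2 * σx ^ 2)) *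
        rexp (-(w - (v + μx * k) / (U + k) * h) ^ 2 /
          (2 * (σ ^ 2 * h * (U + h + k) / (U + k)))) := by
    rw [← Real.exp_add, ← Real.exp_add]
    congr 1
    field_simp
    ring
  rw [hs]
  have h1 : 0 < √(2 * π * (σ ^ 2 * h)) := by positivity
  have h2 : 0 < √(U + h + k) := by positivity
  have h3 : 0 < √(U + k) := by positivity
  have hc : σ / σx / √(U + h + k) * (√(2 * π * (σ ^ 2 * h)))⁻¹ =
      σ / σx / √(U + k) * (√(2 * π * (σ ^ 2 * h)) * √(U + h + k) / √(U + k))⁻¹ := by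
    field_simp
  calc _ = (σ / σx / √(U + h + k) * (√(2 * π * (σ ^ 2 * h)))⁻¹) *
        (rexp ((v + w + μx * k) ^ 2 / (2 * σ ^ 2 * (U + h + k)) - μx ^ 2 / (2 * σx ^ 2)) *
        rexp (-(w - 0) ^ 2 / (2 * (σ ^ 2 * h)))) := by ring
    _ = _ := by rw [hc, hexp]; ring

lemma integrable_gaussianReal_iff {μ : ℝ} {v : NNReal} (hv : v ≠ 0) {f : ℝ → ℝ} :
    Integrable f (gaussianReal μ v) ↔ Integrable (fun x ↦ gaussianPDFReal μ v x * f x) := by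
  rw [gaussianReal_of_var_ne_zero _ hv, integrable_withDensity_iff_integrable_smul'
    (measurable_gaussianPDF _ _) (ae_of_all _ fun _ ↦ gaussianPDF_lt_top)]
  simp

lemma integrable_Lf_mul_iff {σ σx : ℝ} (hσ : 0 < σ) (hσx : 0 < σx) (μx : ℝ) {U h : ℝ}
    (hU : 0 ≤ U) (hh : 0 < h) (v : ℝ) (f : ℝ → ℝ) :
    Integrable (fun w ↦ Lf σ σx μx (U + h) (v + w) * f w)
        (gaussianReal 0 (σ ^ 2 * h).toNNReal) ↔
      Integrable f (gaussianReal (mf σ σx μx U v * h)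
        (σ ^ 2 * h * (U + h + kap σ σx) / (U + kap σ σx)).toNNReal) := by
  have hk := kap_pos hσ hσx
  have h1 : (σ ^ 2 * h).toNNReal ≠ 0 := (Real.toNNReal_pos.2 (by positivity)).ne'
  have h2 : (σ ^ 2 * h * (U + h + kap σ σx) / (U + kap σ σx)).toNNReal ≠ 0 :=
    (Real.toNNReal_pos.2 (by positivity)).ne'
  rw [integrable_gaussianReal_iff h1, integrable_gaussianReal_iff h2,
    ← integrable_const_mul_iff (IsUnit.mk0 _ (Lf_pos hσ hσx μx hU v).ne')
      (fun w ↦ gaussianPDFReal (mf σ σx μx U v * h) _ w * f w)]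
  refine iff_of_eq (congrArg (Integrable · volume) (funext fun w ↦ ?_))
  linear_combination f w * Lf_add_mul_gaussianPDFReal hσ hσx μx hU hh v w

lemma integral_Lf_mul {σ σx : ℝ} (hσ : 0 < σ) (hσx : 0 < σx) (μx : ℝ) {U h : ℝ}
    (hU : 0 ≤ U) (hh : 0 < h) (v : ℝ) (f : ℝ → ℝ) :
    ∫ w, Lf σ σx μx (U + h) (v + w) * f w ∂(gaussianReal 0 (σ ^ 2 * h).toNNReal) =
      Lf σ σx μx U v * ∫ w, f w ∂(gaussianReal (mf σ σx μx U v * h)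
        (σ ^ 2 * h * (U + h + kap σ σx) / (U + kap σ σx)).toNNReal) := by
  have hk := kap_pos hσ hσx
  have h1 : (σ ^ 2 * h).toNNReal ≠ 0 := (Real.toNNReal_pos.2 (by positivity)).ne'
  have h2 : (σ ^ 2 * h * (U + h + kap σ σx) / (U + kap σ σx)).toNNReal ≠ 0 :=
    (Real.toNNReal_pos.2 (by positivity)).ne'
  rw [integral_gaussianReal_eq_integral_smul h1, integral_gaussianReal_eq_integral_smul h2,
    ← integral_const_mul]
  refine integral_congr_ae (ae_of_all _ fun w ↦ ?_)
  simp only [smul_eq_mul]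
  linear_combination f w * Lf_add_mul_gaussianPDFReal hσ hσx μx hU hh v w

lemma integrable_sq_gaussianReal (μ : ℝ) (v : NNReal) :
    Integrable (fun x ↦ x ^ 2) (gaussianReal μ v) :=
  (memLp_id_gaussianReal (μ := μ) (v := v) 2).integrable_sq

lemma integrable_fun_id_gaussianReal (μ : ℝ) (v : NNReal) :
    Integrable (fun x ↦ x) (gaussianReal μ v) :=
  (memLp_id_gaussianReal (μ := μ) (v := v) 1).integrable le_rfl

lemma integral_sq_gaussianReal (μ : ℝ) (v : NNReal) :
    ∫ x, x ^ 2 ∂(gaussianReal μ v) = μ ^ 2 + v := by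
  have h := variance_eq_sub (memLp_id_gaussianReal (μ := μ) (v := v) 2)
  rw [variance_id_gaussianReal] at h
  simp only [Pi.pow_apply, id_eq, integral_id_gaussianReal] at h
  linarith

lemma integrable_quadratic_gaussianReal (μ : ℝ) (v : NNReal) (a b c : ℝ) :
    Integrable (fun x ↦ a + b * x + c * x ^ 2) (gaussianReal μ v) :=
  ((integrable_const a).add ((integrable_fun_id_gaussianReal μ v).const_mul b)).add
    ((integrable_sq_gaussianReal μ v).const_mul c)

lemma integral_quadratic_gaussianReal (μ : ℝ) (v : NNReal) (a b c : ℝ) :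
    ∫ x, (a + b * x + c * x ^ 2) ∂(gaussianReal μ v) = a + b * μ + c * (μ ^ 2 + v) := by
  have h1 := (integrable_fun_id_gaussianReal μ v).const_mul b
  have h2 : Integrable (fun x ↦ a + b * x) (gaussianReal μ v) := (integrable_const a).add h1
  rw [integral_add h2 ((integrable_sq_gaussianReal μ v).const_mul c),
    integral_add (integrable_const a) h1, integral_const_mul, integral_const_mul,
    integral_sq_gaussianReal, integral_id_gaussianReal]
  simp

lemma ellf_add_eq (σ σx μx c₁ ce U h v w : ℝ) :
    ellf σ σx μx c₁ ce (U + h) (v + w) = Lf σ σx μx (U + h) (v + w) *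
      ((c₁ + ce * ((v + μx * kap σ σx) / (U + h + kap σ σx)) ^ 2) +
        (2 * ce * (v + μx * kap σ σx) / (U + h + kap σ σx) ^ 2) * w +
        ce / (U + h + kap σ σx) ^ 2 * w ^ 2) := by
  unfold ellf mf
  congr 1
  simp only [div_eq_mul_inv, mul_pow, inv_pow]
  ring

lemma integrable_ellf_add {σ σx : ℝ} (hσ : 0 < σ) (hσx : 0 < σx) (μx c₁ ce : ℝ) {U h : ℝ}
    (hU : 0 ≤ U) (hh : 0 < h) (v : ℝ) :
    Integrable (fun w ↦ ellf σ σx μx c₁ ce (U + h) (v + w))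
      (gaussianReal 0 (σ ^ 2 * h).toNNReal) := by
  simp only [ellf_add_eq]
  rw [integrable_Lf_mul_iff hσ hσx μx hU hh v]
  exact integrable_quadratic_gaussianReal _ _ _ _ _

lemma integral_ellf_add {σ σx : ℝ} (hσ : 0 < σ) (hσx : 0 < σx) (μx c₁ ce : ℝ) {U h : ℝ}
    (hU : 0 ≤ U) (hh : 0 < h) (v : ℝ) :
    ∫ w, ellf σ σx μx c₁ ce (U + h) (v + w) ∂(gaussianReal 0 (σ ^ 2 * h).toNNReal) =
      Lf σ σx μx U v * (c₁ + ce * (mf σ σx μx U v ^ 2 +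
        σ ^ 2 * h / ((U + kap σ σx) * (U + h + kap σ σx)))) := by
  have hk := kap_pos hσ hσx
  simp only [ellf_add_eq]
  rw [integral_Lf_mul hσ hσx μx hU hh v, integral_quadratic_gaussianReal,
    Real.coe_toNNReal _ (by positivity)]
  unfold mf
  have ha : 0 < U + kap σ σx := by positivity
  have hb : 0 < U + h + kap σ σx := by positivity
  generalize kap σ σx = k at *
  congr 1
  field_simp
  ring

lemma ellf_lt_integral_ellf_add {σ σx c₁ ce : ℝ} (hσ : 0 < σ) (hσx : 0 < σx) (hce : 0 < ce)
    (μx : ℝ) {U h : ℝ} (hU : 0 ≤ U) (hh : 0 < h) (v : ℝ) :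
    ellf σ σx μx c₁ ce U v <
      ∫ w, ellf σ σx μx c₁ ce (U + h) (v + w) ∂(gaussianReal 0 (σ ^ 2 * h).toNNReal) := by
  have hk := kap_pos hσ hσx
  rw [integral_ellf_add hσ hσx μx c₁ ce hU hh v, ellf]
  have := Lf_pos hσ hσx μx hU v
  gcongr
  rw [lt_add_iff_pos_right]
  positivity

lemma Lf_zero_zero {σ σx : ℝ} (hσ : 0 < σ) (hσx : 0 < σx) (μx : ℝ) : Lf σ σx μx 0 0 = 1 := by
  have hs : √(σ ^ 2 / σx ^ 2) = σ / σx := by rw [← div_pow]; exact Real.sqrt_sq (by positivity)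
  unfold Lf kap
  simp only [zero_add, hs]
  rw [div_self (by positivity), one_mul, Real.exp_eq_one_iff]
  field_simp
  ring

lemma mf_zero_zero {σ σx : ℝ} (hσ : 0 < σ) (hσx : 0 < σx) (μx : ℝ) : mf σ σx μx 0 0 = μx := by
  have hk := kap_pos hσ hσx
  unfold mf
  field_simp
  ring

lemma integrable_ellf {σ σx : ℝ} (hσ : 0 < σ) (hσx : 0 < σx) (μx c₁ ce : ℝ) {U : ℝ}
    (hU : 0 < U) :
    Integrable (ellf σ σx μx c₁ ce U) (gaussianReal 0 (σ ^ 2 * U).toNNReal) := by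
  simpa using integrable_ellf_add hσ hσx μx c₁ ce le_rfl hU 0

lemma integral_ellf {σ σx : ℝ} (hσ : 0 < σ) (hσx : 0 < σx) (μx c₁ ce : ℝ) {U : ℝ}
    (hU : 0 < U) :
    ∫ V, ellf σ σx μx c₁ ce U V ∂(gaussianReal 0 (σ ^ 2 * U).toNNReal) =
      c₁ + ce * (μx ^ 2 + σx ^ 2 * (U / (U + kap σ σx))) := by
  have h := integral_ellf_add hσ hσx μx c₁ ce le_rfl hU 0
  have hk := kap_pos hσ hσx
  simp only [zero_add, Lf_zero_zero hσ hσx, mf_zero_zero hσ hσx, one_mul] at h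
  rw [h]
  have : σ ^ 2 = σx ^ 2 * kap σ σx := by unfold kap; field_simp
  rw [this]
  congr 3
  field_simp

lemma Gf_eq_integral_gaussianReal {σ : ℝ} (hσ : 0 < σ) (σx μx c₀ c₁ ce : ℝ) {U : ℝ}
    (hU : 0 < U) :
    Gf σ σx μx c₀ c₁ ce U =
      ∫ V, min 0 (c₀ - ellf σ σx μx c₁ ce U V) ∂(gaussianReal 0 (σ ^ 2 * U).toNNReal) := by
  have h1 : (σ ^ 2 * U).toNNReal ≠ 0 := (Real.toNNReal_pos.2 (by positivity)).ne'
  rw [integral_gaussianReal_eq_integral_smul h1, Gf]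
  refine integral_congr_ae (ae_of_all _ fun V ↦ ?_)
  simp only [gaussianPDFReal, smul_eq_mul, Real.coe_toNNReal _ (show 0 ≤ σ ^ 2 * U by positivity),
    sub_zero, ← mul_assoc]
  ring

lemma integrable_min_zero_sub_ellf {σ σx : ℝ} (hσ : 0 < σ) (hσx : 0 < σx) (μx c₀ c₁ ce : ℝ)
    {U : ℝ} (hU : 0 < U) :
    Integrable (fun V ↦ min 0 (c₀ - ellf σ σx μx c₁ ce U V))
      (gaussianReal 0 (σ ^ 2 * U).toNNReal) :=
  (integrable_const 0).inf ((integrable_const c₀).sub (integrable_ellf hσ hσx μx c₁ ce hU))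

lemma Gf_eq_integral_min_sub {σ σx : ℝ} (hσ : 0 < σ) (hσx : 0 < σx) (μx c₀ c₁ ce : ℝ)
    {U : ℝ} (hU : 0 < U) :
    Gf σ σx μx c₀ c₁ ce U =
      ∫ z, min c₀ (ellf σ σx μx c₁ ce U (σ * √U * z)) ∂(gaussianReal 0 1) -
        (c₁ + ce * (μx ^ 2 + σx ^ 2 * (U / (U + kap σ σx)))) := by
  have hmap : (gaussianReal 0 1).map (σ * √U * ·) = gaussianReal 0 (σ ^ 2 * U).toNNReal := by
    rw [gaussianReal_map_const_mul]
    congr 1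
    · simp
    · ext
      rw [Real.coe_toNNReal _ (by positivity)]
      simp [mul_pow, Real.sq_sqrt hU.le]
  have hcont : Continuous fun V ↦ min c₀ (ellf σ σx μx c₁ ce U V) :=
    continuous_const.min (continuous_ellf μx c₁ ce U)
  have hint : Integrable (fun V ↦ min c₀ (ellf σ σx μx c₁ ce U V))
      (gaussianReal 0 (σ ^ 2 * U).toNNReal) :=
    (integrable_const c₀).inf (integrable_ellf hσ hσx μx c₁ ce hU)
  have hmin : ∫ z, min c₀ (ellf σ σx μx c₁ ce U (σ * √U * z)) ∂(gaussianReal 0 1) =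
      ∫ V, min c₀ (ellf σ σx μx c₁ ce U V) ∂(gaussianReal 0 (σ ^ 2 * U).toNNReal) := by
    rw [← hmap, integral_map (by fun_prop) hcont.aestronglyMeasurable]
  rw [hmin, ← integral_ellf hσ hσx μx c₁ ce hU, Gf_eq_integral_gaussianReal hσ _ _ _ _ _ hU,
    ← integral_sub hint (integrable_ellf hσ hσx μx c₁ ce hU)]
  refine integral_congr_ae (ae_of_all _ fun V ↦ ?_)
  beta_reduce
  rw [← min_sub_sub_right, sub_self, min_comm]

lemma exists_lt_ellf {σ σx c₁ ce : ℝ} (hσ : 0 < σ) (hσx : 0 < σx) (hc₁ : 0 < c₁)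
    (hce : 0 < ce) (μx : ℝ) {U : ℝ} (hU : 0 ≤ U) (c : ℝ) : ∃ V, c < ellf σ σx μx c₁ ce U V := by
  have hk := kap_pos hσ hσx
  have hlim : Tendsto (fun V ↦ Lf σ σx μx U V * c₁) atTop atTop := by
    unfold Lf
    refine Tendsto.atTop_mul_const hc₁ (Tendsto.const_mul_atTop (by positivity) ?_)
    refine Real.tendsto_exp_atTop.comp (tendsto_atTop_add_const_right _ _ ?_)
    refine Tendsto.atTop_div_const (by positivity) ?_
    exact (tendsto_pow_atTop two_ne_zero).comp (tendsto_atTop_add_const_right _ _ tendsto_id)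
  obtain ⟨V, hV⟩ := (hlim.eventually_gt_atTop c).exists
  refine ⟨V, hV.trans_le ?_⟩
  have := Lf_pos hσ hσx μx hU V
  unfold ellf
  gcongr
  rw [le_add_iff_nonneg_right]
  positivity

lemma Gf_strictAntiOn {σ σx c₁ ce : ℝ} (hσ : 0 < σ) (hσx : 0 < σx) (hc₁ : 0 < c₁)
    (hce : 0 < ce) (μx c₀ : ℝ) : StrictAntiOn (Gf σ σx μx c₀ c₁ ce) (Ioi 0) := by
  intro U hU U' hU' hlt
  obtain ⟨h, hh, rfl⟩ : ∃ h, 0 < h ∧ U' = U + h := ⟨U' - U, sub_pos.2 hlt, by ring⟩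
  rw [mem_Ioi] at hU hU'
  set ν := gaussianReal 0 (σ ^ 2 * h).toNNReal
  set g : ℝ → ℝ → ℝ := fun U V ↦ min 0 (c₀ - ellf σ σx μx c₁ ce U V)
  have hconv : gaussianReal 0 (σ ^ 2 * (U + h)).toNNReal =
      (gaussianReal 0 (σ ^ 2 * U).toNNReal).conv ν := by
    rw [gaussianReal_conv_gaussianReal, add_zero, mul_add,
      Real.toNNReal_add (by positivity) (by positivity)]
  have hint := integrable_min_zero_sub_ellf hσ hσx μx c₀ c₁ ce hU'
  rw [hconv] at hint
  have hgc (U : ℝ) : Continuous (g U) :=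
    continuous_const.min (continuous_const.sub (continuous_ellf μx c₁ ce U))
  have hI (v : ℝ) : Integrable (fun w ↦ ellf σ σx μx c₁ ce (U + h) (v + w)) ν :=
    integrable_ellf_add hσ hσx μx c₁ ce hU.le hh v
  have hgI (v : ℝ) : Integrable (fun w ↦ g (U + h) (v + w)) ν :=
    (integrable_const 0).inf ((integrable_const c₀).sub (hI v))
  have hle (v : ℝ) : ∫ w, g (U + h) (v + w) ∂ν ≤
      c₀ - ∫ w, ellf σ σx μx c₁ ce (U + h) (v + w) ∂ν := by
    calc _ ≤ ∫ w, (c₀ - ellf σ σx μx c₁ ce (U + h) (v + w)) ∂ν :=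
          integral_mono (hgI v) ((integrable_const c₀).sub (hI v)) fun w ↦ min_le_right _ _
      _ = _ := by rw [integral_sub (integrable_const c₀) (hI v)]; simp
  have hlt' (v : ℝ) : ∫ w, g (U + h) (v + w) ∂ν < c₀ - ellf σ σx μx c₁ ce U v := by
    have := ellf_lt_integral_ellf_add (c₁ := c₁) hσ hσx hce μx hU.le hh v
    linarith [hle v]
  have hnonpos (v : ℝ) : ∫ w, g (U + h) (v + w) ∂ν ≤ 0 :=
    integral_nonpos fun w ↦ min_le_left _ _
  have hg := integrable_min_zero_sub_ellf hσ hσx μx c₀ c₁ ce hU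
  have hK : Integrable (fun v ↦ ∫ w, g (U + h) (v + w) ∂ν)
      (gaussianReal 0 (σ ^ 2 * U).toNNReal) :=
    ((integrable_map_measure (hgc (U + h)).aestronglyMeasurable (by fun_prop)).1
      hint).integral_prod_left
  rw [Gf_eq_integral_gaussianReal hσ _ _ _ _ _ hU, Gf_eq_integral_gaussianReal hσ _ _ _ _ _ hU',
    hconv, integral_conv hint, ← sub_pos, ← integral_sub hg hK,
    integral_pos_iff_support_of_nonneg
      (fun v ↦ sub_nonneg.2 (le_min (hnonpos v) (hlt' v).le)) (hg.sub hK)]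
  have hopen : IsOpen {v | c₀ < ellf σ σx μx c₁ ce U v} :=
    isOpen_lt continuous_const (continuous_ellf μx c₁ ce U)
  have hpos := hopen.measure_pos volume (exists_lt_ellf hσ hσx hc₁ hce μx hU.le c₀)
  have hv : (σ ^ 2 * U).toNNReal ≠ 0 := (Real.toNNReal_pos.2 (by positivity)).ne'
  refine (pos_iff_ne_zero.2 fun h0 ↦
    hpos.ne' (gaussianReal_absolutelyContinuous' 0 hv h0)).trans_le (measure_mono fun v (hcv : c₀ < _) ↦ ?_)
  refine (sub_pos.2 ?_).ne'
  rw [min_eq_right (by linarith)]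
  exact hlt' v

lemma ellf_tendsto_zero {σ σx c₁ ce : ℝ} (hσ : 0 < σ) (hσx : 0 < σx) (hc₁ : 0 < c₁)
    (hce : 0 < ce) (μx z : ℝ) :
    Tendsto (fun U ↦ ellf σ σx μx c₁ ce U (σ * √U * z)) atTop (𝓝 0) := by
  have hk := kap_pos hσ hσx
  set k := kap σ σx with hkdef
  set B := z ^ 2 + μx ^ 2 * k / σ ^ 2 with hB
  have hB0 : 0 ≤ B := by positivity
  have hinv : Tendsto (fun U ↦ (σ / σx * rexp B * (c₁ + ce * (2 * σ ^ 2 * B / k))) / √(U + k))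
      atTop (𝓝 0) :=
    (Real.tendsto_sqrt_atTop.comp (tendsto_atTop_add_const_right _ _ tendsto_id)).const_div_atTop _
  refine tendsto_of_tendsto_of_tendsto_of_le_of_le' tendsto_const_nhds hinv ?_ ?_
  · filter_upwards [eventually_ge_atTop 0] with U hU
    exact ellf_nonneg hσ hσx hc₁ hce μx hU _
  · filter_upwards [eventually_ge_atTop 0] with U hU
    have hUk : 0 < U + k := by positivity
    have hsq : (σ * √U * z + μx * k) ^ 2 ≤ 2 * σ ^ 2 * (U + k) * B := by
      have h1 : (σ * √U * z) ^ 2 = σ ^ 2 * U * z ^ 2 := by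
        rw [mul_pow, mul_pow, Real.sq_sqrt hU]
      have h2 : 2 * σ ^ 2 * (U + k) * B = 2 * (σ ^ 2 * U * z ^ 2) + 2 * (μx * k) ^ 2 +
          (2 * σ ^ 2 * k * z ^ 2 + 2 * U * μx ^ 2 * k) := by
        rw [hB]; field_simp; ring
      have h3 : 0 ≤ 2 * σ ^ 2 * k * z ^ 2 + 2 * U * μx ^ 2 * k := by positivity
      nlinarith [sq_nonneg (σ * √U * z - μx * k)]
    have hL : Lf σ σx μx U (σ * √U * z) ≤ σ / σx / √(U + k) * rexp B := by
      unfold Lf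
      rw [← hkdef]
      gcongr
      have : (σ * √U * z + μx * k) ^ 2 / (2 * σ ^ 2 * (U + k)) ≤ B := by
        rw [div_le_iff₀ (by positivity)]; linarith
      have : 0 ≤ μx ^ 2 / (2 * σx ^ 2) := by positivity
      linarith
    have hm : mf σ σx μx U (σ * √U * z) ^ 2 ≤ 2 * σ ^ 2 * B / k := by
      unfold mf
      rw [← hkdef, div_pow, div_le_div_iff₀ (by positivity) hk]
      calc _ ≤ 2 * σ ^ 2 * (U + k) * B * k := by gcongr
        _ ≤ 2 * σ ^ 2 * (U + k) * B * (U + k) := by gcongr; linarith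
        _ = _ := by ring
    calc ellf σ σx μx c₁ ce U (σ * √U * z)
        ≤ (σ / σx / √(U + k) * rexp B) * (c₁ + ce * (2 * σ ^ 2 * B / k)) := by
          unfold ellf; gcongr
      _ = _ := by ring

lemma norm_min_ellf_le {σ σx c₀ c₁ ce : ℝ} (hσ : 0 < σ) (hσx : 0 < σx) (hc₀ : 0 < c₀)
    (hc₁ : 0 < c₁) (hce : 0 < ce) (μx : ℝ) {U : ℝ} (hU : 0 ≤ U) (V : ℝ) :
    ‖min c₀ (ellf σ σx μx c₁ ce U V)‖ ≤ c₀ := by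
  rw [Real.norm_of_nonneg (le_min hc₀.le (ellf_nonneg hσ hσx hc₁ hce μx hU V))]
  exact min_le_left _ _

lemma aestronglyMeasurable_min_ellf (σ σx μx c₀ c₁ ce U a : ℝ) (ρ : Measure ℝ) :
    AEStronglyMeasurable (fun z ↦ min c₀ (ellf σ σx μx c₁ ce U (a * z))) ρ :=
  (continuous_const.min
    ((continuous_ellf μx c₁ ce U).comp (continuous_const_mul a))).aestronglyMeasurable

lemma continuousOn_integral_min_ellf {σ σx c₀ c₁ ce : ℝ} (hσ : 0 < σ) (hσx : 0 < σx)
    (hc₀ : 0 < c₀) (hc₁ : 0 < c₁) (hce : 0 < ce) (μx : ℝ) :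
    ContinuousOn
      (fun U ↦ ∫ z, min c₀ (ellf σ σx μx c₁ ce U (σ * √U * z)) ∂(gaussianReal 0 1)) (Ici 0) := by
  have hk := kap_pos hσ hσx
  refine continuousOn_of_dominated (bound := fun _ ↦ c₀)
    (fun U _ ↦ aestronglyMeasurable_min_ellf _ _ _ _ _ _ _ _ _)
    (fun U hU ↦ ae_of_all _ fun z ↦ norm_min_ellf_le hσ hσx hc₀ hc₁ hce μx hU _)
    (integrable_const _) (ae_of_all _ fun z ↦ continuousOn_const.inf ?_)
  have h1 : ∀ U ∈ Ici (0 : ℝ), U + kap σ σx ≠ 0 := fun U hU ↦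
    (add_pos_of_nonneg_of_pos hU hk).ne'
  have h2 : ∀ U ∈ Ici (0 : ℝ), √(U + kap σ σx) ≠ 0 := fun U hU ↦
    (Real.sqrt_pos.2 (add_pos_of_nonneg_of_pos hU hk)).ne'
  have h3 : ∀ U ∈ Ici (0 : ℝ), 2 * σ ^ 2 * (U + kap σ σx) ≠ 0 := fun U hU ↦
    mul_ne_zero (by positivity) (h1 U hU)
  unfold ellf Lf mf
  fun_prop (disch := assumption)

lemma tendsto_integral_min_ellf {σ σx c₀ c₁ ce : ℝ} (hσ : 0 < σ) (hσx : 0 < σx)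
    (hc₀ : 0 < c₀) (hc₁ : 0 < c₁) (hce : 0 < ce) (μx : ℝ) :
    Tendsto (fun U ↦ ∫ z, min c₀ (ellf σ σx μx c₁ ce U (σ * √U * z)) ∂(gaussianReal 0 1))
      atTop (𝓝 0) := by
  have h := tendsto_integral_filter_of_dominated_convergence (μ := gaussianReal 0 1)
    (l := atTop) (f := fun _ ↦ (0 : ℝ))
    (F := fun U z ↦ min c₀ (ellf σ σx μx c₁ ce U (σ * √U * z))) (fun _ ↦ c₀)
    (Eventually.of_forall fun U ↦ aestronglyMeasurable_min_ellf _ _ _ _ _ _ _ _ _)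
    ((eventually_ge_atTop 0).mono fun U hU ↦ ae_of_all _ fun z ↦
      norm_min_ellf_le hσ hσx hc₀ hc₁ hce μx hU _)
    (integrable_const _) (ae_of_all _ fun z ↦ by
      simpa [hc₀.le] using (tendsto_const_nhds (x := c₀)).min
        (ellf_tendsto_zero hσ hσx hc₁ hce μx z))
  simpa using h

/-- for 0 < C < min{c₀, c₁ + c_e μx²} + c_e σx², the equation
G(γ) = C − c₁ − c_e(μx² + σx²) has a unique solution γ > 0. -/
theorem threshold_gamma_exists_unique (σ σx μx c₀ c₁ ce C : ℝ)
    (hσ : 0 < σ) (hσx : 0 < σx) (hc₀ : 0 < c₀) (hc₁ : 0 < c₁) (hce : 0 < ce)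
    (hC0 : 0 < C) (hC1 : C < min c₀ (c₁ + ce * μx ^ 2) + ce * σx ^ 2) :
    ∃! γ : ℝ, 0 < γ ∧
      Gf σ σx μx c₀ c₁ ce γ = C - c₁ - ce * (μx ^ 2 + σx ^ 2) := by
  have hk := kap_pos hσ hσx
  set F : ℝ → ℝ := fun U ↦
    ∫ z, min c₀ (ellf σ σx μx c₁ ce U (σ * √U * z)) ∂(gaussianReal 0 1) -
      (c₁ + ce * (μx ^ 2 + σx ^ 2 * (U / (U + kap σ σx)))) with hF
  have hGF {U : ℝ} (hU : 0 < U) : Gf σ σx μx c₀ c₁ ce U = F U :=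
    Gf_eq_integral_min_sub hσ hσx μx c₀ c₁ ce hU
  have hFcont : ContinuousOn F (Ici 0) := by
    have h1 : ∀ U ∈ Ici (0 : ℝ), U + kap σ σx ≠ 0 := fun U hU ↦
      (add_pos_of_nonneg_of_pos hU hk).ne'
    refine (continuousOn_integral_min_ellf hσ hσx hc₀ hc₁ hce μx).sub ?_
    fun_prop (disch := assumption)
  have hF0 : C - c₁ - ce * (μx ^ 2 + σx ^ 2) < F 0 := by
    simp only [hF, Real.sqrt_zero, mul_zero, zero_mul, ellf, Lf_zero_zero hσ hσx,
      mf_zero_zero hσ hσx, one_mul, zero_div, add_zero, integral_const, probReal_univ, one_smul]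
    linarith
  have hFtop : Tendsto F atTop (𝓝 (0 - (c₁ + ce * (μx ^ 2 + σx ^ 2 * 1)))) := by
    have hfrac : Tendsto (fun U ↦ U / (U + kap σ σx)) atTop (𝓝 1) := by
      have h := ((tendsto_atTop_add_const_right atTop (kap σ σx) tendsto_id).const_div_atTop
        (kap σ σx)).const_sub 1
      rw [sub_zero] at h
      refine h.congr' ?_
      filter_upwards [eventually_ge_atTop 0] with U hU
      have : U + kap σ σx ≠ 0 := by positivity
      simp only [id]
      field_simp
      ring
    exact (tendsto_integral_min_ellf hσ hσx hc₀ hc₁ hce μx).sub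
      (((hfrac.const_mul _).const_add _).const_mul ce |>.const_add c₁)
  obtain ⟨R, hRC, hR⟩ := ((hFtop.eventually_lt_const
    (show _ < C - c₁ - ce * (μx ^ 2 + σx ^ 2) by linarith)).and (eventually_ge_atTop 0)).exists
  obtain ⟨γ, hγ, hγC⟩ := intermediate_value_Ioo' hR
    (hFcont.mono Icc_subset_Ici_self) ⟨hRC, hF0⟩
  refine ⟨γ, ⟨hγ.1, (hGF hγ.1).trans hγC⟩, fun δ hδ ↦ ?_⟩
  exact (Gf_strictAntiOn hσ hσx hc₁ hce μx c₀).injOn hδ.1 hγ.1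
    (hδ.2.trans ((hGF hγ.1).trans hγC).symm)
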